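/- Let I be an ideal of ℚ̄(z)[X_1,…,X_m] and set I_r := I ∩ ℚ̄(z)[X_1,…,X_r] for some r ≤ m. Then there exists a finite set S ⊂ ℚ̄ such that for every α ∈ ℚ̄ \ S one has ev_α(I) ∩ ℚ̄[X_1,…,X_r] = ev_α(I_r). -/

import Mathlib

noncomputable section

/-- `ℚ̄`, the field of algebraic numbers, realized as the relative algebraic closure
of `ℚ` inside `ℂ`. -/
abbrev Qb : IntermediateField ℚ ℂ := algebraicClosure ℚ ℂ

/-- `evSet α J` : the set (in fact ideal) of polynomials of `ℚ̄[X₁, …, X_m]` obtained by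
evaluating at `z = α` those elements of `J` lying in `ℚ̄[z, X₁, …, X_m]`. -/
def evSet {m : ℕ} (α : Qb) (J : Set (MvPolynomial (Fin m) (RatFunc Qb))) :
    Set (MvPolynomial (Fin m) Qb) :=
  {P | ∃ Q : MvPolynomial (Fin m) (Polynomial Qb),
        MvPolynomial.map (algebraMap (Polynomial Qb) (RatFunc Qb)) Q ∈ J ∧
        P = MvPolynomial.map (Polynomial.evalRingHom α) Q}

/-- Lexicographic monomial order in which later variables are larger. -/
def elimOrd (m : ℕ) : MonomialOrder (Fin m) := MonomialOrder.lex (σ := (Fin m)ᵒᵈ)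

theorem elimOrd_le {m r : ℕ} {a b : Fin m →₀ ℕ}
    (h : (elimOrd m).toSyn a ≤ (elimOrd m).toSyn b)
    (hb : ∀ v, b v ≠ 0 → (v : ℕ) < r) : ∀ v, a v ≠ 0 → (v : ℕ) < r := by
  rcases h.eq_or_lt with h | h
  · rw [(elimOrd m).toSyn.injective h]; exact hb
  · obtain ⟨j, hj, hlt⟩ := (Finsupp.Lex.lt_iff (α := (Fin m)ᵒᵈ)).1
      ((MonomialOrder.lex_lt_iff (σ := (Fin m)ᵒᵈ)).1 h)
    have hjr : ((OrderDual.ofDual j : Fin m) : ℕ) < r := hb _ (Nat.ne_zero_of_lt hlt)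
    intro v hv
    by_contra hvr
    have h1 : (OrderDual.ofDual j : Fin m) < v := by
      rw [Fin.lt_def]; omega
    have h2 : a v = b v := hj (OrderDual.toDual v) (OrderDual.toDual_lt_toDual.2 h1)
    exact hvr (hb v (h2 ▸ hv))

theorem elim_aux {K : Type*} [Field K] {m r : ℕ}
    (J : Ideal (MvPolynomial (Fin m) (Polynomial K)))
    (T : Set (MvPolynomial (Fin m) (Polynomial K)))
    (hTJ : ∀ g ∈ T, g ∈ J)
    (hT : ∀ f ∈ J, f ≠ 0 → ∃ g ∈ T, (elimOrd m).degree g ≤ (elimOrd m).degree f)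
    (α : K) (hα : ∀ g ∈ T, ((elimOrd m).leadingCoeff g).eval α ≠ 0)
    (d : (elimOrd m).syn) :
    ∀ Q ∈ J, (elimOrd m).toSyn ((elimOrd m).degree Q) = d →
      (∀ v ∈ (MvPolynomial.map (Polynomial.evalRingHom α) Q).vars, (v : ℕ) < r) →
      ∃ Q' ∈ J, (∀ v ∈ Q'.vars, (v : ℕ) < r) ∧
        MvPolynomial.map (Polynomial.evalRingHom α) Q'
          = MvPolynomial.map (Polynomial.evalRingHom α) Q := by
  induction d using WellFoundedLT.induction with
  | ind d ih =>
  intro Q hQ hd hv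
  by_cases hdeg : ∀ v, (elimOrd m).degree Q v ≠ 0 → (v : ℕ) < r
  · refine ⟨Q, hQ, fun v hvQ => ?_, rfl⟩
    obtain ⟨e, he, hve⟩ := (MvPolynomial.mem_vars_iff_mem_support v).1 hvQ
    exact elimOrd_le ((elimOrd m).le_degree he) hdeg v (Finsupp.mem_support_iff.1 hve)
  · have hQ0 : Q ≠ 0 := by
      rintro rfl; simp at hdeg
    have hd0 : (elimOrd m).degree Q ≠ 0 := by
      intro h; simp [h] at hdeg
    -- the leading coefficient vanishes at α
    have hlc : ((elimOrd m).leadingCoeff Q).eval α = 0 := by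
      by_contra hne
      apply hdeg
      intro v hvd
      apply hv
      refine (MvPolynomial.mem_vars_iff_mem_support v).2
        ⟨(elimOrd m).degree Q, ?_, Finsupp.mem_support_iff.2 hvd⟩
      rw [MvPolynomial.mem_support_iff, MvPolynomial.coeff_map]
      exact hne
    obtain ⟨g, hgT, hle⟩ := hT Q hQ hQ0
    obtain ⟨a, ha⟩ := exists_add_of_le hle
    set c := (elimOrd m).leadingCoeff g with hc
    set l := (elimOrd m).leadingCoeff Q with hl
    let R := MvPolynomial.C c * Q - MvPolynomial.monomial a l * g
    have hRJ : R ∈ J := J.sub_mem (J.mul_mem_left _ hQ) (J.mul_mem_left _ (hTJ g hgT))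
    have hcoeff : ∀ e, (elimOrd m).toSyn ((elimOrd m).degree Q) ≤ (elimOrd m).toSyn e →
        R.coeff e = 0 := by
      intro e he
      rcases he.eq_or_lt with he | he
      · have := (elimOrd m).toSyn.injective he
        subst this
        have h1 : (MvPolynomial.monomial a l * g).coeff ((elimOrd m).degree Q) = l * c := by
          rw [ha, add_comm, MvPolynomial.coeff_monomial_mul]; rfl
        have h2 : (MvPolynomial.C c * Q).coeff ((elimOrd m).degree Q) = c * l := by
          rw [MvPolynomial.coeff_C_mul]; rfl
        simp only [R, MvPolynomial.coeff_sub, h1, h2]; ring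
      · have h2 : Q.coeff e = 0 := (elimOrd m).coeff_eq_zero_of_lt he
        have h1 : (MvPolynomial.monomial a l * g).coeff e = 0 := by
          apply (elimOrd m).coeff_eq_zero_of_lt
          refine lt_of_le_of_lt ?_ he
          refine ((elimOrd m).toSyn_degree_mul_le).trans ?_
          rw [ha, add_comm ((elimOrd m).degree g), map_add]
          gcongr
          exact (elimOrd m).degree_monomial_le l
        simp only [R, MvPolynomial.coeff_sub, h1, MvPolynomial.coeff_C_mul, h2]; ring
    have hlt : (elimOrd m).toSyn ((elimOrd m).degree R) < d := by
      rw [← hd, (elimOrd m).degree_lt_iff]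
      · intro e he
        by_contra hcon
        exact (MvPolynomial.mem_support_iff.1 he) (hcoeff e (not_lt.1 hcon))
      · rw [map_zero]
        exact (elimOrd m).toSyn_lt_iff_ne_zero.2
          (fun h => hd0 (((elimOrd m).toSyn_eq_zero_iff _).1 h))
    have hRev : MvPolynomial.map (Polynomial.evalRingHom α) R
        = MvPolynomial.C (c.eval α) * MvPolynomial.map (Polynomial.evalRingHom α) Q := by
      simp [R, hlc, MvPolynomial.map_monomial]
    have hcα : c.eval α ≠ 0 := hα g hgT
    obtain ⟨Q', hQ'J, hQ'v, hQ'e⟩ := ih _ hlt R hRJ rfl (by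
      intro v hvR
      apply hv
      rw [hRev] at hvR
      obtain ⟨e, he, hve⟩ := (MvPolynomial.mem_vars_iff_mem_support v).1 hvR
      refine (MvPolynomial.mem_vars_iff_mem_support v).2 ⟨e, ?_, hve⟩
      rw [MvPolynomial.mem_support_iff, MvPolynomial.coeff_C_mul] at he
      exact MvPolynomial.mem_support_iff.2 (right_ne_zero_of_mul he))
    refine ⟨MvPolynomial.C (Polynomial.C (c.eval α)⁻¹) * Q', J.mul_mem_left _ hQ'J, ?_, ?_⟩
    · intro v hvR
      apply hQ'v
      obtain ⟨e, he, hve⟩ := (MvPolynomial.mem_vars_iff_mem_support v).1 hvR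
      refine (MvPolynomial.mem_vars_iff_mem_support v).2 ⟨e, ?_, hve⟩
      rw [MvPolynomial.mem_support_iff, MvPolynomial.coeff_C_mul] at he
      exact MvPolynomial.mem_support_iff.2 (right_ne_zero_of_mul he)
    · rw [map_mul, hQ'e, hRev, MvPolynomial.map_C, ← mul_assoc, ← MvPolynomial.C_mul]
      simp [hcα]

theorem exists_T {K : Type*} [Field K] {m : ℕ}
    (J : Ideal (MvPolynomial (Fin m) (Polynomial K))) :
    ∃ T : Set (MvPolynomial (Fin m) (Polynomial K)), T.Finite ∧ (∀ g ∈ T, g ∈ J ∧ g ≠ 0) ∧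
      ∀ f ∈ J, f ≠ 0 → ∃ g ∈ T, (elimOrd m).degree g ≤ (elimOrd m).degree f := by
  let D : (Fin m →₀ ℕ) → Prop := fun d => ∃ f ∈ J, f ≠ 0 ∧ (elimOrd m).degree f = d
  have hfin : {d | Minimal D d}.Finite :=
    WellQuasiOrderedLE.finite_of_isAntichain (setOfPred_minimal_antichain D)
  have hch : ∀ d : Fin m →₀ ℕ, ∃ f, D d → f ∈ J ∧ f ≠ 0 ∧ (elimOrd m).degree f = d := by
    intro d
    by_cases h : D d
    · obtain ⟨f, hf⟩ := h
      exact ⟨f, fun _ => hf⟩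
    · exact ⟨0, fun h' => absurd h' h⟩
  choose F hF using hch
  refine ⟨F '' {d | Minimal D d}, hfin.image F, ?_, ?_⟩
  · rintro _ ⟨d, hd, rfl⟩
    exact ⟨(hF d hd.prop).1, (hF d hd.prop).2.1⟩
  · intro f hf hf0
    obtain ⟨d, hle, hd⟩ := exists_minimal_le_of_wellFoundedLT D _ ⟨f, hf, hf0, rfl⟩
    exact ⟨F d, ⟨d, hd, rfl⟩, by rw [(hF d hd.prop).2.2]; exact hle⟩

/-- For an ideal `I` of `ℚ̄(z)[X₁, …, X_m]` and `I_r := I ∩ ℚ̄(z)[X₁, …, X_r]`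
(`r ≤ m`), there is a finite set `S ⊂ ℚ̄` such that for all `α ∈ ℚ̄ \ S`,
`ev_α(I) ∩ ℚ̄[X₁, …, X_r] = ev_α(I_r)`. -/
theorem evaluation_elimination_ideal
    (m r : ℕ) (hrm : r ≤ m)
    (I : Ideal (MvPolynomial (Fin m) (RatFunc Qb))) :
    ∃ S : Finset Qb, ∀ α : Qb, α ∉ S →
      evSet α (I : Set (MvPolynomial (Fin m) (RatFunc Qb)))
          ∩ {P : MvPolynomial (Fin m) Qb | ∀ v ∈ P.vars, (v : ℕ) < r}
        = evSet α ((I : Set (MvPolynomial (Fin m) (RatFunc Qb)))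
          ∩ {Q : MvPolynomial (Fin m) (RatFunc Qb) | ∀ v ∈ Q.vars, (v : ℕ) < r}) := by
  classical
  have hinj : Function.Injective (algebraMap (Polynomial Qb) (RatFunc Qb)) :=
    RatFunc.algebraMap_injective Qb
  obtain ⟨T, hTf, hT1, hT2⟩ := exists_T
    (I.comap (MvPolynomial.map (algebraMap (Polynomial Qb) (RatFunc Qb))))
  refine ⟨hTf.toFinset.biUnion fun g => ((elimOrd m).leadingCoeff g).roots.toFinset, ?_⟩
  intro α hα
  have hα' : ∀ g ∈ T, ((elimOrd m).leadingCoeff g).eval α ≠ 0 := by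
    intro g hg h0
    apply hα
    refine Finset.mem_biUnion.2 ⟨g, hTf.mem_toFinset.2 hg, ?_⟩
    rw [Multiset.mem_toFinset, Polynomial.mem_roots
      ((elimOrd m).leadingCoeff_ne_zero_iff.2 (hT1 g hg).2)]
    exact h0
  ext P
  constructor
  · rintro ⟨⟨Q, hQ, rfl⟩, hv⟩
    obtain ⟨Q', hJ, hv', he⟩ := elim_aux (r := r) _ T (fun g hg => (hT1 g hg).1) hT2 α hα' _ Q
      (Ideal.mem_comap.2 hQ) rfl hv
    refine ⟨Q', ⟨Ideal.mem_comap.1 hJ, ?_⟩, he.symm⟩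
    intro v hvQ
    rw [MvPolynomial.vars_map_of_injective _ hinj] at hvQ
    exact hv' v hvQ
  · rintro ⟨Q, ⟨hQ, hv⟩, rfl⟩
    refine ⟨⟨Q, hQ, rfl⟩, ?_⟩
    intro v hvQ
    apply hv v
    rw [MvPolynomial.vars_map_of_injective _ hinj]
    exact MvPolynomial.vars_map _ _ hvQ
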